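/- For every real q ≥ 2, the fixed-point equation Q = exp(−q·(1 − Q)) has a solution Q with exp(−q) < Q < 2·exp(−q). Equivalently, writing P = 1 − Q, the mean-field equation P = 1 − exp(−q·P) has a solution P satisfying 1 − 2·exp(−q) < P < 1 − exp(−q); in particular the probability of not belonging to the infinite cluster in the mean-field percolation model is O(exp(−q)). -/

import Mathlib

/-- For every `q ≥ 2`, the fixed-point equation
`Q = exp(-q·(1 - Q))` has a solution with `exp(-q) < Q < 2·exp(-q)`;
equivalently, `P = 1 - Q` solves the mean-field equation `P = 1 - exp(-q·P)`
and satisfies `1 - 2·exp(-q) < P < 1 - exp(-q)`. -/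
theorem mean_field_fixed_point_exists
    (q : ℝ) (hq : 2 ≤ q) :
    ∃ Q : ℝ, Q = Real.exp (-(q * (1 - Q))) ∧
      Real.exp (-q) < Q ∧ Q < 2 * Real.exp (-q) ∧
      (1 - Q) = 1 - Real.exp (-(q * (1 - Q))) ∧
      1 - 2 * Real.exp (-q) < 1 - Q ∧ 1 - Q < 1 - Real.exp (-q) := by
  have hE : 0 < Real.exp (-q) := Real.exp_pos _
  have h1 : q * Real.exp (-q) ≤ 2 * Real.exp (-2) := by
    have h := Real.add_one_le_exp (q - 2)
    have h2 : Real.exp (-2) = Real.exp (q - 2) * Real.exp (-q) := by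
      rw [← Real.exp_add]; congr 1; ring
    rw [h2]
    nlinarith
  have h2 : Real.exp (-2) < 0.17 := by
    have h3 := Real.exp_one_gt_d9
    have h4 : Real.exp (-2) * (Real.exp 1 * Real.exp 1) = 1 := by
      rw [← Real.exp_add, ← Real.exp_add]; norm_num
    have h5 : 7 < Real.exp 1 * Real.exp 1 := by nlinarith
    nlinarith [Real.exp_pos (-2)]
  have h3 : 2 * (q * Real.exp (-q)) < Real.log 2 := by
    have := Real.log_two_gt_d9
    linarith
  have h4 : Real.exp (2 * (q * Real.exp (-q))) < 2 := by
    rwa [← Real.lt_log_iff_exp_lt (by norm_num)]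
  have key : ∀ Q : ℝ, Real.exp (-(q * (1 - Q))) = Real.exp (-q) * Real.exp (q * Q) := by
    intro Q
    rw [← Real.exp_add]; congr 1; ring
  have hc : ContinuousOn (fun Q : ℝ => Real.exp (-(q * (1 - Q))) - Q)
      (Set.Icc (Real.exp (-q)) (2 * Real.exp (-q))) := by fun_prop
  have hmem : (0 : ℝ) ∈ Set.Ioo
      ((fun Q : ℝ => Real.exp (-(q * (1 - Q))) - Q) (2 * Real.exp (-q)))
      ((fun Q : ℝ => Real.exp (-(q * (1 - Q))) - Q) (Real.exp (-q))) := by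
    constructor
    · simp only [key]
      rw [show q * (2 * Real.exp (-q)) = 2 * (q * Real.exp (-q)) by ring]
      nlinarith
    · simp only [key]
      have : 1 < Real.exp (q * Real.exp (-q)) := Real.one_lt_exp_iff.2 (by positivity)
      nlinarith
  obtain ⟨Q, ⟨ha, hb⟩, hQ⟩ := intermediate_value_Ioo' (by linarith) hc hmem
  simp only at hQ
  exact ⟨Q, by linarith, ha, hb, by linarith, by linarith, by linarith⟩
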